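/- For any T×N complex matrix C of full rank min(T,N), the real dimension of the space {Y ∈ ℂ^{T×N} : C^H Y + Y^H C = 0} equals 2TN - N² when T ≥ N, and is at most T² when T < N; hence the maximum achievable code rate of an unbalanced 2-group-decodable STBC with one symbol in the first group is (2TN - N² + 1)/(2T) for T ≥ N and (T² + 1)/(2T) for T < N. -/

import Mathlib

open Matrix

/-- The real-linear map `Y ↦ Cᴴ Y + Yᴴ C` encoding the quasi-orthogonality
constraint system. -/
noncomputable def qocMap {T N : ℕ} (C : Matrix (Fin T) (Fin N) ℂ) :
    Matrix (Fin T) (Fin N) ℂ →ₗ[ℝ] Matrix (Fin N) (Fin N) ℂ where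
  toFun Y := Cᴴ * Y + Yᴴ * C
  map_add' Y Z := by
    simp [Matrix.conjTranspose_add, Matrix.mul_add, Matrix.add_mul]
    abel
  map_smul' r Y := by
    simp [Matrix.conjTranspose_smul, Matrix.mul_smul, Matrix.smul_mul, smul_add]

open scoped ComplexOrder in
lemma aux_left_inv {T N : ℕ} (C : Matrix (Fin T) (Fin N) ℂ) (h : C.rank = N) :
    ∃ L : Matrix (Fin N) (Fin T) ℂ, L * C = 1 := by
  have h1 : (Cᴴ * C).rank = Fintype.card (Fin N) := by
    rw [Matrix.rank_conjTranspose_mul_self, h, Fintype.card_fin]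
  have h2 : IsUnit (Cᴴ * C) := by
    rw [← Matrix.mulVec_surjective_iff_isUnit]
    have h3 : LinearMap.range (Cᴴ * C).mulVecLin = ⊤ := by
      apply Submodule.eq_top_of_finrank_eq
      rw [Module.finrank_fintype_fun_eq_card]
      exact h1
    exact LinearMap.range_eq_top.mp h3
  refine ⟨(Cᴴ * C)⁻¹ * Cᴴ, ?_⟩
  rw [Matrix.mul_assoc]
  exact Matrix.nonsing_inv_mul _ ((Matrix.isUnit_iff_isUnit_det _).mp h2)

lemma aux_apply {T N : ℕ} (C Y : Matrix (Fin T) (Fin N) ℂ) :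
    qocMap C Y = Cᴴ * Y + Yᴴ * C := rfl

lemma aux_mem_range {N : ℕ} (X : Matrix (Fin N) (Fin N) ℂ) :
    X ∈ LinearMap.range (qocMap (1 : Matrix (Fin N) (Fin N) ℂ)) ↔ Xᴴ = X := by
  constructor
  · rintro ⟨Y, rfl⟩
    simp [aux_apply, add_comm]
  · intro h
    refine ⟨(1 / 2 : ℝ) • X, ?_⟩
    rw [aux_apply]
    simp only [conjTranspose_one, one_mul, mul_one, conjTranspose_smul, h, ← add_smul]
    norm_num

lemma aux_mem_ker {N : ℕ} (X : Matrix (Fin N) (Fin N) ℂ) :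
    X ∈ LinearMap.ker (qocMap (1 : Matrix (Fin N) (Fin N) ℂ)) ↔ Xᴴ = -X := by
  rw [LinearMap.mem_ker, aux_apply]
  simp only [conjTranspose_one, one_mul, mul_one]
  rw [add_comm, add_eq_zero_iff_eq_neg]

noncomputable def auxI (N : ℕ) : Matrix (Fin N) (Fin N) ℂ →ₗ[ℝ] Matrix (Fin N) (Fin N) ℂ where
  toFun X := Complex.I • X
  map_add' X Y := smul_add _ _ _
  map_smul' r X := smul_comm _ _ _

lemma auxI_inj (N : ℕ) : Function.Injective (auxI N) := by
  intro X Y h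
  exact smul_right_injective _ Complex.I_ne_zero h

lemma aux_dims (N : ℕ) :
    Module.finrank ℝ (LinearMap.range (qocMap (1 : Matrix (Fin N) (Fin N) ℂ))) = N ^ 2 ∧
    Module.finrank ℝ (LinearMap.ker (qocMap (1 : Matrix (Fin N) (Fin N) ℂ))) = N ^ 2 := by
  have h0 := LinearMap.finrank_range_add_finrank_ker (qocMap (1 : Matrix (Fin N) (Fin N) ℂ))
  rw [Module.finrank_matrix, Complex.finrank_real_complex, Fintype.card_fin] at h0
  have h1 : Module.finrank ℝ (LinearMap.range (qocMap (1 : Matrix (Fin N) (Fin N) ℂ))) ≤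
      Module.finrank ℝ (LinearMap.ker (qocMap (1 : Matrix (Fin N) (Fin N) ℂ))) := by
    refine LinearMap.finrank_le_finrank_of_injective
      (f := (auxI N).restrict (p := LinearMap.range _) (q := LinearMap.ker _) ?_) ?_
    · intro X hX
      rw [aux_mem_range] at hX
      rw [aux_mem_ker]
      simp [auxI, conjTranspose_smul, hX]
    · intro X Y h
      exact Subtype.ext (auxI_inj N (congrArg Subtype.val h))
  have h2 : Module.finrank ℝ (LinearMap.ker (qocMap (1 : Matrix (Fin N) (Fin N) ℂ))) ≤
      Module.finrank ℝ (LinearMap.range (qocMap (1 : Matrix (Fin N) (Fin N) ℂ))) := by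
    refine LinearMap.finrank_le_finrank_of_injective
      (f := (auxI N).restrict (p := LinearMap.ker _) (q := LinearMap.range _) ?_) ?_
    · intro X hX
      rw [aux_mem_ker] at hX
      rw [aux_mem_range]
      simp [auxI, conjTranspose_smul, hX]
    · intro X Y h
      exact Subtype.ext (auxI_inj N (congrArg Subtype.val h))
  constructor <;> nlinarith

lemma aux_tall {T N : ℕ} (C : Matrix (Fin T) (Fin N) ℂ) (h : C.rank = N) :
    Module.finrank ℝ (LinearMap.ker (qocMap C)) + N ^ 2 = 2 * T * N := by
  obtain ⟨L, hL⟩ := aux_left_inv C h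
  have hr : LinearMap.range (qocMap C) =
      LinearMap.range (qocMap (1 : Matrix (Fin N) (Fin N) ℂ)) := by
    ext X
    rw [aux_mem_range]
    constructor
    · rintro ⟨Y, rfl⟩
      simp [aux_apply, conjTranspose_mul, add_comm]
    · intro hX
      have hL' : Cᴴ * Lᴴ = 1 := by rw [← conjTranspose_mul, hL, conjTranspose_one]
      refine ⟨(1 / 2 : ℝ) • (Lᴴ * X), ?_⟩
      rw [aux_apply, conjTranspose_smul, conjTranspose_mul, conjTranspose_conjTranspose,
        Matrix.mul_smul, Matrix.smul_mul, ← Matrix.mul_assoc, hL', Matrix.mul_assoc, hL, hX,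
        one_mul, mul_one, star_trivial, ← add_smul]
      norm_num
  have h0 := LinearMap.finrank_range_add_finrank_ker (qocMap C)
  rw [Module.finrank_matrix, Complex.finrank_real_complex, Fintype.card_fin, Fintype.card_fin,
    hr, (aux_dims N).1] at h0
  linarith

open scoped ComplexOrder in
lemma aux_wide {T N : ℕ} (C : Matrix (Fin T) (Fin N) ℂ) (h : C.rank = T) :
    Module.finrank ℝ (LinearMap.ker (qocMap C)) ≤ T ^ 2 := by
  obtain ⟨L, hL⟩ := aux_left_inv Cᴴ (by rw [Matrix.rank_conjTranspose, h])
  have hL' : C * Lᴴ = 1 := by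
    rw [← conjTranspose_conjTranspose C, ← conjTranspose_mul, hL, conjTranspose_one]
  rw [← (aux_dims T).2]
  let g : Matrix (Fin T) (Fin N) ℂ →ₗ[ℝ] Matrix (Fin T) (Fin T) ℂ :=
    { toFun := fun Y => Y * Lᴴ
      map_add' := fun X Y => Matrix.add_mul _ _ _
      map_smul' := fun r X => Matrix.smul_mul _ _ _ }
  have key : ∀ Y ∈ LinearMap.ker (qocMap C), Y = -((Y * Lᴴ)ᴴ * C) := by
    intro Y hY
    rw [LinearMap.mem_ker, aux_apply] at hY
    have := congrArg (fun Z => L * Z) hY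
    simp only [Matrix.mul_add, ← Matrix.mul_assoc, hL, Matrix.one_mul, Matrix.mul_zero] at this
    rw [conjTranspose_mul, conjTranspose_conjTranspose]
    exact eq_neg_of_add_eq_zero_left this
  refine LinearMap.finrank_le_finrank_of_injective
      (f := g.restrict (p := LinearMap.ker _) (q := LinearMap.ker _) ?_) ?_
  · intro Y hY
    rw [aux_mem_ker]
    have := congrArg (fun Z => Z * Lᴴ) (key Y hY)
    simp only [Matrix.neg_mul, Matrix.mul_assoc, hL', Matrix.mul_one] at this
    change (Y * Lᴴ)ᴴ = -(Y * Lᴴ)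
    rw [eq_neg_iff_add_eq_zero, add_comm, ← eq_neg_iff_add_eq_zero]
    exact this
  · rw [← LinearMap.ker_eq_bot, LinearMap.ker_eq_bot']
    rintro ⟨Y, hY⟩ h0
    have h1 : Y * Lᴴ = 0 := congrArg Subtype.val h0
    have h2 := key Y hY
    rw [h1] at h2
    apply Subtype.ext
    simpa using h2

/-- For a full-rank `T×N` matrix `C`, the real dimension `K` of the admissible
solution space `{Y : Cᴴ Y + Yᴴ C = 0}` equals `2TN - N²` when `T ≥ N` and is at
most `T²` when `T < N`; hence the maximum code rate `(K+1)/(2T)` of an unbalanced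
2-group-decodable STBC is `(2TN - N² + 1)/(2T)` for `T ≥ N`, and at most
`(T² + 1)/(2T)` for `T < N`. -/
theorem stmt8 (T N : ℕ) (hT : 0 < T) (hN : 0 < N) (C : Matrix (Fin T) (Fin N) ℂ)
    (hrank : C.rank = min T N) :
    (N ≤ T →
      Module.finrank ℝ (LinearMap.ker (qocMap C)) = 2 * T * N - N ^ 2 ∧
      ((Module.finrank ℝ (LinearMap.ker (qocMap C)) : ℚ) + 1) / (2 * T) =
        (2 * T * N - N ^ 2 + 1) / (2 * T)) ∧
    (T < N →
      Module.finrank ℝ (LinearMap.ker (qocMap C)) ≤ T ^ 2 ∧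
      ((Module.finrank ℝ (LinearMap.ker (qocMap C)) : ℚ) + 1) / (2 * T) ≤
        (T ^ 2 + 1) / (2 * T)) := by
  refine ⟨fun h => ?_, fun h => ?_⟩
  · have h1 := aux_tall C (by rw [hrank, min_eq_right h])
    refine ⟨by omega, ?_⟩
    have h2 : (Module.finrank ℝ (LinearMap.ker (qocMap C)) : ℚ) = 2 * T * N - N ^ 2 := by
      rw [eq_sub_iff_add_eq]
      exact_mod_cast h1
    rw [h2]
  · have h1 := aux_wide C (by rw [hrank, min_eq_left h.le])
    refine ⟨h1, ?_⟩
    have h2 : (Module.finrank ℝ (LinearMap.ker (qocMap C)) : ℚ) ≤ T ^ 2 := by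
      exact_mod_cast h1
    gcongr
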